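/- arXiv:2310.12984 — 2 statements merged into one kernel-verified Lean document; each statement's English description precedes it below -/
import Mathlib

section
/- Let n be a high extremal point of J, let m be the next high extremal point after n (i.e., m is a high extremal point, m > n, and there is no high extremal point strictly between n and m), and set f := n − J(n) and r := n mod 2. Then, as integers, 2·J(m) = 3·n + (2 − 3·r)·(2·f − 1). -/
/-- The Josephus function with reduction constant 3:
`J 1 = 1` and `J n = ((J (n-1) + 2) % n) + 1` for `n ≥ 2`. -/
def J : ℕ → ℕ
  | 0 => 0
  | 1 => 1
  | n + 2 => (J (n + 1) + 2) % (n + 2) + 1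

/-- `n ≥ 1` is a high extremal point if `J n ∈ {n-1, n}`. -/
def IsHighExtremal (n : ℕ) : Prop := 1 ≤ n ∧ (J n = n - 1 ∨ J n = n)

theorem J_succ_of_pos {n : ℕ} (hn : 1 ≤ n) : J (n + 1) = (J n + 2) % (n + 1) + 1 := by
  obtain ⟨k, rfl⟩ := Nat.exists_eq_add_of_le' hn
  rfl

/-- After a high extremal point, `J` restarts at `2 - f` and grows in steps of `3`
until it reaches the next high extremal point. -/
theorem J_add_of_high_extremal {n f : ℕ} (hn : 1 ≤ n) (hf : f ≤ 1) (hJ : J n + f = n) (k : ℕ)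
    (hk : 2 * k < n + f) : J (n + 1 + k) + f = 2 + 3 * k := by
  induction k with
  | zero =>
    have hmod : (J n + 2) % (n + 1) = 1 - f := by
      rw [show J n + 2 = 1 - f + (n + 1) by omega, Nat.add_mod_right, Nat.mod_eq_of_lt (by omega)]
    rw [Nat.add_zero, J_succ_of_pos hn, hmod]
    omega
  | succ k ih =>
    have ih := ih (by omega)
    rw [← Nat.add_assoc, J_succ_of_pos (by omega), Nat.mod_eq_of_lt (by omega)]
    omega

theorem stmt_7 (n m : ℕ) (hn : IsHighExtremal n)
    (hm : IsHighExtremal m) (hlt : n < m)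
    (hnext : ∀ k, n < k → k < m → ¬ IsHighExtremal k)
    (f r : ℤ) (hf : f = (n : ℤ) - (J n : ℤ)) (hr : r = (n : ℤ) % 2) :
    2 * (J m : ℤ) = 3 * (n : ℤ) + (2 - 3 * r) * (2 * f - 1) := by
  obtain ⟨hn1, hJn⟩ := hn
  obtain ⟨g, hg, hJg⟩ : ∃ g ≤ 1, J n + g = n := by
    rcases hJn with h | h
    · exact ⟨1, le_rfl, by omega⟩
    · exact ⟨0, by omega, by omega⟩
  have key := J_add_of_high_extremal hn1 hg hJg
  obtain ⟨k, rfl⟩ := Nat.exists_eq_add_of_le (Nat.succ_le_of_lt hlt)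
  rw [Nat.succ_eq_add_one] at *
  have hle : k ≤ (n + g - 1) / 2 := by
    by_contra! hlt'
    have hK := key ((n + g - 1) / 2) (by omega)
    exact hnext (n + 1 + (n + g - 1) / 2) (by omega) (by omega) ⟨by omega, by omega⟩
  have hJm := key k (by omega)
  obtain ⟨-, hm⟩ := hm
  have hfg : f = g := by omega
  obtain hr' | hr' : r = 0 ∨ r = 1 := by omega
  all_goals
    rw [hr']
    omega
end

section
/- Let p be a fixed point of J, let q be the next fixed point after p (i.e., q is a fixed point, q > p, and there is no fixed point strictly between p and q), and let m̄ be the 2-adic valuation of 3·p + 2. Let n satisfy p < n ≤ q, and let 𝔪 be the least natural number k such that 2^k·(2·n + 1) ≤ 3^k·(3·p + 2) (equivalently, 𝔪 = ⌈log_{3/2}((2n+1)/(3p+2))⌉). Then 𝔪 ≤ m̄ and 3^{m̄−𝔪}·J(n) = 3^{m̄−𝔪}·(3·n + 1) − 2^{m̄−𝔪}·(2·q + 1); equivalently, as rationals, J(n) = 3n + 1 − (2/3)^{m̄−𝔪}·(2q + 1). -/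
/-- The Josephus recurrence at the successor of a positive number. -/
theorem J_succ (n : ℕ) (hn : 1 ≤ n) : J (n + 1) = (J n + 2) % (n + 1) + 1 := by
  obtain ⟨m, rfl⟩ : ∃ m, n = m + 1 := ⟨n - 1, by omega⟩
  rfl

/-- Along a run without wrap-around, `J` grows with slope `3`. -/
theorem J_add_eq_of_le {Y a n : ℕ} (hJ : J a + Y = 3 * a + 1) (han : a ≤ n)
    (hn : 2 * n + 1 ≤ Y) : J n + Y = 3 * n + 1 := by
  induction n, han using Nat.le_induction with
  | base => exact hJ
  | succ n han ih =>
    have := ih (by omega)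
    rw [J_succ n (by omega), Nat.mod_eq_of_lt (by omega)]
    omega

/-- The explicit form of `J` on the `k`-th run after a fixed point `p`. -/
theorem J_add_eq_of_run {p c M : ℕ} (hp1 : 1 ≤ p) (hp : J p = p) (hc : 3 * p + 2 = 2 ^ M * c)
    (k d : ℕ) (hkd : k + d = M) (n : ℕ) (hpn : p < n)
    (hlow : ∀ j, k = j + 1 → 3 ^ j * 2 ^ (d + 1) * c < 2 * n + 1)
    (hup : 2 * n + 1 ≤ 3 ^ k * 2 ^ d * c) : J n + 3 ^ k * 2 ^ d * c = 3 * n + 1 := by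
  have hc0 : 0 < c := by
    rcases Nat.eq_zero_or_pos c with rfl | h
    · omega
    · exact h
  induction k generalizing d n with
  | zero =>
    obtain rfl : d = M := by omega
    rw [pow_zero, one_mul, ← hc] at hup ⊢
    refine J_add_eq_of_le (a := p + 1) ?_ hpn hup
    have hmod : (p + 2) % (p + 1) = 1 := by
      rw [show p + 2 = (p + 1) + 1 from rfl, Nat.add_mod_left, Nat.mod_eq_of_lt (by omega)]
    rw [J_succ p hp1, hp, hmod]
    omega
  | succ k ih =>
    obtain ⟨Z, hZ⟩ : ∃ Z, Z = 3 ^ k * 2 ^ d * c := ⟨_, rfl⟩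
    have h2 : 3 ^ k * 2 ^ (d + 1) * c = 2 * Z := by rw [hZ]; ring
    have h3 : 3 ^ (k + 1) * 2 ^ d * c = 3 * Z := by rw [hZ]; ring
    have hpZ : 3 * p + 2 ≤ 2 * Z := by
      rw [hc, ← h2, ← hkd, show k + 1 + d = k + (d + 1) by omega, pow_add]
      gcongr
      norm_num
    have hlow' := hlow k rfl
    rw [h2] at hlow'
    rw [h3] at hup ⊢
    have key := ih (d + 1) (by omega) (Z - 1) (by omega) (by
      rintro j rfl
      have hW : 0 < 3 ^ j * 2 ^ d * c := by positivity
      have e1 : 3 ^ j * 2 ^ (d + 1 + 1) * c = 4 * (3 ^ j * 2 ^ d * c) := by ring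
      have e2 : Z = 3 * (3 ^ j * 2 ^ d * c) := by rw [hZ]; ring
      omega) (by omega)
    rw [h2] at key
    refine J_add_eq_of_le (a := Z) ?_ (by omega) hup
    have hs := J_succ (Z - 1) (by omega)
    rw [show Z - 1 + 1 = Z by omega, show J (Z - 1) + 2 = Z by omega, Nat.mod_self] at hs
    omega

/-- The run containing `n` is the one indexed by the least `k` with
`2 * n + 1 ≤ (3 / 2) ^ k * (3 * p + 2)`. -/
theorem J_add_eq_of_isLeast {p c M n m : ℕ} (hp1 : 1 ≤ p) (hp : J p = p)
    (hc : 3 * p + 2 = 2 ^ M * c) (hpn : p < n) (hn : 2 * n + 1 ≤ 3 ^ M * c)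
    (hm : IsLeast {k : ℕ | 2 ^ k * (2 * n + 1) ≤ 3 ^ k * (3 * p + 2)} m) :
    m ≤ M ∧ J n + 3 ^ m * 2 ^ (M - m) * c = 3 * n + 1 := by
  have hmM : m ≤ M := hm.2 (by
    change 2 ^ M * (2 * n + 1) ≤ 3 ^ M * (3 * p + 2)
    rw [hc, mul_left_comm]
    gcongr)
  refine ⟨hmM, ?_⟩
  obtain ⟨d, rfl⟩ := Nat.exists_eq_add_of_le hmM
  rw [Nat.add_sub_cancel_left]
  refine J_add_eq_of_run hp1 hp hc m d rfl n hpn ?_ ?_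
  · rintro j rfl
    by_contra! h
    have : j + 1 ≤ j := hm.2 (by
      change 2 ^ j * (2 * n + 1) ≤ 3 ^ j * (3 * p + 2)
      calc 2 ^ j * (2 * n + 1) ≤ 2 ^ j * (3 ^ j * 2 ^ (d + 1) * c) := by gcongr
        _ = 3 ^ j * (3 * p + 2) := by rw [hc]; ring)
    omega
  · have h : 2 ^ m * (2 * n + 1) ≤ 3 ^ m * (3 * p + 2) := hm.1
    refine Nat.le_of_mul_le_mul_left (h.trans_eq ?_) (pow_pos (by norm_num : 0 < 2) m)
    rw [hc]; ring

/-- The first fixed point `q` after a fixed point `p` with `3 * p + 2 = 2 ^ M * c`, `c` odd,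
satisfies `2 * q + 1 = 3 ^ M * c`. -/
theorem two_mul_next_fixed_add_one {p q c M : ℕ} (hp1 : 1 ≤ p) (hp : J p = p) (hq : J q = q)
    (hlt : p < q) (hnext : ∀ k, p < k → k < q → J k ≠ k) (hc : 3 * p + 2 = 2 ^ M * c)
    (hodd : Odd c) : 2 * q + 1 = 3 ^ M * c := by
  have hM : Odd (3 ^ M * c) := (Odd.pow (by decide)).mul hodd
  have hle : 3 * p + 2 ≤ 3 ^ M * c := by rw [hc]; gcongr; norm_num
  have hleast : ∀ n, 2 * n + 1 ≤ 3 ^ M * c →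
      ∃ m, IsLeast {k : ℕ | 2 ^ k * (2 * n + 1) ≤ 3 ^ k * (3 * p + 2)} m := fun n hn =>
    ⟨_, isLeast_csInf ⟨M, by
      change 2 ^ M * (2 * n + 1) ≤ 3 ^ M * (3 * p + 2)
      rw [hc, mul_left_comm]
      gcongr⟩⟩
  have hfix : ∀ n, p < n → 2 * n + 1 ≤ 3 ^ M * c → J n = n → 2 * n + 1 = 3 ^ M * c := by
    intro n hpn hn hJ
    obtain ⟨m, hm⟩ := hleast n hn
    obtain ⟨hmM, h⟩ := J_add_eq_of_isLeast hp1 hp hc hpn hn hm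
    obtain ⟨d, rfl⟩ := Nat.exists_eq_add_of_le hmM
    rw [Nat.add_sub_cancel_left] at h
    cases d with
    | zero => simp only [pow_zero, mul_one, add_zero] at h ⊢; omega
    | succ d =>
      have : 3 ^ m * 2 ^ (d + 1) * c = 2 * (3 ^ m * 2 ^ d * c) := by ring
      omega
  obtain ⟨N, hN⟩ := hM
  have hJN : J N = N := by
    have h := J_add_eq_of_run hp1 hp hc M 0 rfl N (by omega) (by
      rintro j rfl
      have e : 3 ^ (j + 1) * c = 3 * (3 ^ j * c) := by ring
      have e' : 3 ^ j * 2 ^ (0 + 1) * c = 2 * (3 ^ j * c) := by ring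
      omega) (by simp [hN])
    simp only [pow_zero, mul_one] at h
    omega
  rcases lt_trichotomy N q with h | h | h
  · exact absurd hJN (hnext N (by omega) h)
  · omega
  · exact hfix q hlt (by omega) hq

theorem stmt_14 (p q : ℕ) (hp1 : 1 ≤ p) (hp : J p = p)
    (hq : J q = q) (hlt : p < q)
    (hnext : ∀ k, p < k → k < q → J k ≠ k)
    (mbar : ℕ) (hmbar : mbar = padicValNat 2 (3 * p + 2))
    (n : ℕ) (hn1 : p < n) (hn2 : n ≤ q)
    (mfrak : ℕ)
    (hmfrak : IsLeast {k : ℕ | 2 ^ k * (2 * n + 1) ≤ 3 ^ k * (3 * p + 2)} mfrak) :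
    mfrak ≤ mbar ∧
      (3 : ℤ) ^ (mbar - mfrak) * (J n : ℤ) =
        3 ^ (mbar - mfrak) * (3 * (n : ℤ) + 1) -
          2 ^ (mbar - mfrak) * (2 * (q : ℤ) + 1) := by
  obtain ⟨c, hodd, hc⟩ : ∃ c, Odd c ∧ 3 * p + 2 = 2 ^ mbar * c := by
    obtain ⟨c, hc⟩ := (pow_padicValNat_dvd : 2 ^ padicValNat 2 (3 * p + 2) ∣ 3 * p + 2)
    refine ⟨c, ?_, hmbar ▸ hc⟩
    rw [← Nat.not_even_iff_odd, even_iff_two_dvd]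
    rintro ⟨e, rfl⟩
    exact pow_succ_padicValNat_not_dvd (p := 2) (n := 3 * p + 2) (by omega)
      ⟨e, by rw [pow_succ, mul_assoc]; exact hc⟩
  have hq' := two_mul_next_fixed_add_one hp1 hp hq hlt hnext hc hodd
  obtain ⟨hm, h⟩ := J_add_eq_of_isLeast hp1 hp hc hn1 (by omega) hmfrak
  refine ⟨hm, ?_⟩
  clear hmfrak hmbar
  obtain ⟨d, rfl⟩ := Nat.exists_eq_add_of_le hm
  rw [Nat.add_sub_cancel_left] at h ⊢
  zify at h hq'
  rw [hq', ← h]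
  ring
end
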